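/- There exists a constant C > 0 such that for every n ≥ 2 and every stable tree T of the tree connection game with n agents, the in-degree of the root r in T is at most 2^{C·√(log₂ n)}. -/

import Mathlib

open Function
open scoped ENNReal Classical

noncomputable section

namespace TCG

variable {n : ℕ}

/-- In-degree of node `v` in the network induced by profile `s` with root `r`:
the number of activated edges `(u, v)` with `u` an agent (a non-root node). -/
def indeg (r : Fin (n + 1)) (s : Fin (n + 1) → Fin (n + 1)) (v : Fin (n + 1)) : ℕ :=
  Nat.card {u : Fin (n + 1) | u ≠ r ∧ s u = v}

/-- `|T(u)|`: the number of nodes having a directed path to `u` (including `u` itself). -/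
def subtreeSize (s : Fin (n + 1) → Fin (n + 1)) (u : Fin (n + 1)) : ℕ :=
  Nat.card {w : Fin (n + 1) | ∃ k, s^[k] w = u}

/-- Cost of the agent at node `v` with respect to the root `r`:
the sum, over the edges `(u, u')` of the unique directed path from `v` to `r`,
of `indeg(u') / |T(u)|`; the cost is `∞` if no such path exists. -/
def cost (r : Fin (n + 1)) (s : Fin (n + 1) → Fin (n + 1)) (v : Fin (n + 1)) : ℝ≥0∞ :=
  if h : ∃ k, s^[k] v = r then
    ∑ k ∈ Finset.range (Nat.find h),
      (indeg r s (s^[k + 1] v) : ℝ≥0∞) / (subtreeSize s (s^[k] v) : ℝ≥0∞)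
  else ⊤

/-- A valid strategy profile: the root is absorbing (a formal convention encoding that the
root activates no edge), and every agent chooses a node different from herself. -/
def ValidProfile (r : Fin (n + 1)) (s : Fin (n + 1) → Fin (n + 1)) : Prop :=
  s r = r ∧ ∀ v, v ≠ r → s v ≠ v

/-- Pure Nash equilibrium (the induced network is *stable*): no agent can strictly
decrease her cost by unilaterally switching her activated edge to another node. -/
def IsStable (r : Fin (n + 1)) (s : Fin (n + 1) → Fin (n + 1)) : Prop :=
  ValidProfile r s ∧
    ∀ v, v ≠ r → ∀ w, w ≠ v → cost r s v ≤ cost r (Function.update s v w) v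

/-- Social cost: the sum of the costs of all agents (the non-root nodes). -/
def SC (s : Fin (n + 1) → Fin (n + 1)) : ℝ≥0∞ :=
  ∑ v ∈ Finset.univ.erase (0 : Fin (n + 1)), cost 0 s v

/-- Height of the induced network: the maximum length of a (leaf-to-)root path,
i.e. the least `k` such that every node arrives at the root after `k` steps. -/
def height (s : Fin (n + 1) → Fin (n + 1)) : ℕ :=
  sInf {k | ∀ v, s^[k] v = 0}

/-- Fairness Ratio: maximum agent cost divided by minimum agent cost. -/
def FR (s : Fin (n + 1) → Fin (n + 1)) : ℝ≥0∞ :=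
  (⨆ (v : Fin (n + 1)) (_ : v ≠ 0), cost 0 s v) /
    (⨅ (v : Fin (n + 1)) (_ : v ≠ 0), cost 0 s v)

/-- If every node reaches `0`, the number of steps it needs to do so. -/
def depth (s : Fin (n + 1) → Fin (n + 1)) (hs : ∀ v, ∃ k, s^[k] v = 0) (v : Fin (n + 1)) : ℕ :=
  Nat.find (hs v)

lemma depth_zero (s : Fin (n + 1) → Fin (n + 1)) (hs : ∀ v, ∃ k, s^[k] v = 0) :
    depth s hs 0 = 0 := by
  simp [depth]

lemma depth_of_ne_zero (s : Fin (n + 1) → Fin (n + 1)) (hs : ∀ v, ∃ k, s^[k] v = 0)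
    {v : Fin (n + 1)} (hv : v ≠ 0) : depth s hs v = depth s hs (s v) + 1 := by
  have h0 : ∃ k, s^[k + 1] v = 0 := by
    simpa only [Function.iterate_succ_apply] using hs (s v)
  exact Nat.find_comp_succ (hs v) h0 (by simpa using hv)

lemma depth_eq_add_of_iterate (s : Fin (n + 1) → Fin (n + 1)) (hs : ∀ v, ∃ k, s^[k] v = 0)
    (h0 : s 0 = 0) {u : Fin (n + 1)} (hu : u ≠ 0) (k : ℕ) :
    ∀ w, s^[k] w = u → depth s hs w = depth s hs u + k := by
  induction k with
  | zero => rintro w rfl; simp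
  | succ k ih =>
    intro w hw
    have hw0 : w ≠ 0 := by
      rintro rfl
      exact hu (hw.symm.trans (Function.iterate_fixed h0 _))
    rw [depth_of_ne_zero s hs hw0, ih (s w) hw, add_assoc]

lemma eq_of_common_descendant (s : Fin (n + 1) → Fin (n + 1)) (hs : ∀ v, ∃ k, s^[k] v = 0)
    (h0 : s 0 = 0) {u v w : Fin (n + 1)} (hu : u ≠ 0) (hv : v ≠ 0) (huv : s u = s v)
    (hwu : ∃ k, s^[k] w = u) (hwv : ∃ k, s^[k] w = v) : u = v := by
  obtain ⟨k, hk⟩ := hwu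
  obtain ⟨l, hl⟩ := hwv
  have h1 := depth_eq_add_of_iterate s hs h0 hu k w hk
  have h2 := depth_eq_add_of_iterate s hs h0 hv l w hl
  have h3 := depth_of_ne_zero s hs hu
  have h4 := depth_of_ne_zero s hs hv
  rw [huv] at h3
  obtain rfl : k = l := by omega
  exact hk.symm.trans hl

lemma subtreeSize_pos (s : Fin (n + 1) → Fin (n + 1)) (u : Fin (n + 1)) :
    0 < subtreeSize s u := by
  unfold subtreeSize
  rw [Nat.card_coe_set_eq, Set.ncard_pos]
  exact ⟨u, 0, rfl⟩

lemma cost_zero (s : Fin (n + 1) → Fin (n + 1)) : cost 0 s 0 = 0 := by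
  have h : ∃ k, s^[k] 0 = 0 := ⟨0, rfl⟩
  have hf : Nat.find h = 0 := by simp
  rw [cost, dif_pos h, hf, Finset.range_zero, Finset.sum_empty]

lemma cost_of_ne_zero (s : Fin (n + 1) → Fin (n + 1)) (hs : ∀ v, ∃ k, s^[k] v = 0)
    {v : Fin (n + 1)} (hv : v ≠ 0) :
    cost 0 s v = (indeg 0 s (s v) : ℝ≥0∞) / (subtreeSize s v : ℝ≥0∞) + cost 0 s (s v) := by
  have hf : Nat.find (hs v) = Nat.find (hs (s v)) + 1 := depth_of_ne_zero s hs hv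
  rw [cost, dif_pos (hs v), cost, dif_pos (hs (s v)), hf, Finset.sum_range_succ', add_comm]
  rfl

lemma cost_ne_top (s : Fin (n + 1) → Fin (n + 1)) (hs : ∀ v, ∃ k, s^[k] v = 0)
    (v : Fin (n + 1)) : cost 0 s v ≠ ⊤ := by
  rw [cost, dif_pos (hs v)]
  refine ENNReal.sum_ne_top.2 fun k _ => ?_
  refine ENNReal.div_ne_top (ENNReal.natCast_ne_top _) ?_
  exact_mod_cast (subtreeSize_pos s _).ne'

lemma indeg_update_le (s : Fin (n + 1) → Fin (n + 1)) {v u w : Fin (n + 1)} (hw : w ≠ u) :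
    indeg 0 (update s v u) w ≤ indeg 0 s w := by
  unfold indeg
  rw [Nat.card_coe_set_eq, Nat.card_coe_set_eq]
  refine Set.ncard_le_ncard ?_ (Set.toFinite _)
  rintro y ⟨hy, hyw⟩
  by_cases h : y = v
  · subst h
    simp only [update_self] at hyw
    exact absurd hyw.symm hw
  · exact ⟨hy, by rwa [update_of_ne h] at hyw⟩

lemma indeg_update_target_le (s : Fin (n + 1) → Fin (n + 1)) (v u : Fin (n + 1)) :
    indeg 0 (update s v u) u ≤ indeg 0 s u + 1 := by
  unfold indeg
  rw [Nat.card_coe_set_eq, Nat.card_coe_set_eq]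
  refine le_trans (Set.ncard_le_ncard ?_ (Set.toFinite _))
    (Set.ncard_insert_le v {y | y ≠ 0 ∧ s y = u})
  rintro y ⟨hy, hyw⟩
  by_cases h : y = v
  · exact Or.inl h
  · exact Or.inr ⟨hy, by rwa [update_of_ne h] at hyw⟩

lemma indeg_update_source_add_one_le (s : Fin (n + 1) → Fin (n + 1)) {v u : Fin (n + 1)}
    (hv : v ≠ 0) (hu : s v ≠ u) :
    indeg 0 (update s v u) (s v) + 1 ≤ indeg 0 s (s v) := by
  unfold indeg
  rw [Nat.card_coe_set_eq, Nat.card_coe_set_eq]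
  have hnot : v ∉ {y | y ≠ 0 ∧ update s v u y = s v} := by
    rintro ⟨-, h⟩
    rw [update_self] at h
    exact hu h.symm
  rw [← Set.ncard_insert_of_notMem hnot (Set.toFinite _)]
  refine Set.ncard_le_ncard ?_ (Set.toFinite _)
  rintro y (rfl | ⟨hy, hyw⟩)
  · exact ⟨hv, rfl⟩
  · refine ⟨hy, ?_⟩
    by_cases h : y = v
    · rw [h]
    · rwa [update_of_ne h] at hyw

lemma reach_update_sibling (s : Fin (n + 1) → Fin (n + 1)) {v u : Fin (n + 1)}
    (huv : u ≠ v) (hs : s u = s v) (k : ℕ) :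
    ∀ w, ∃ l, (update s v u)^[l] w = s^[k] w := by
  induction k with
  | zero => exact fun w => ⟨0, rfl⟩
  | succ k ih =>
    intro w
    obtain ⟨l, hl⟩ := ih (s w)
    rw [iterate_succ_apply, ← hl]
    by_cases h : w = v
    · refine ⟨l + 2, ?_⟩
      rw [iterate_succ_apply, iterate_succ_apply, h, update_self, update_of_ne huv, hs]
    · exact ⟨l + 1, by rw [iterate_succ_apply, update_of_ne h]⟩

lemma subtreeSize_le_update (s : Fin (n + 1) → Fin (n + 1)) {v u : Fin (n + 1)}
    (huv : u ≠ v) (hs : s u = s v) (w : Fin (n + 1)) :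
    subtreeSize s w ≤ subtreeSize (update s v u) w := by
  unfold subtreeSize
  rw [Nat.card_coe_set_eq, Nat.card_coe_set_eq]
  refine Set.ncard_le_ncard ?_ (Set.toFinite _)
  rintro y ⟨k, rfl⟩
  exact reach_update_sibling s huv hs k y

lemma subtreeSize_add_le_update (s : Fin (n + 1) → Fin (n + 1)) (hs : ∀ v, ∃ k, s^[k] v = 0)
    (h0 : s 0 = 0) {v u : Fin (n + 1)} (hv : v ≠ 0) (hu : u ≠ 0) (huv : u ≠ v)
    (h : s u = s v) :
    subtreeSize s v + subtreeSize s u ≤ subtreeSize (update s v u) u := by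
  unfold subtreeSize
  rw [Nat.card_coe_set_eq, Nat.card_coe_set_eq, Nat.card_coe_set_eq,
    ← Set.ncard_union_eq ?_ (Set.toFinite _) (Set.toFinite _)]
  · refine Set.ncard_le_ncard ?_ (Set.toFinite _)
    rintro y (⟨k, hk⟩ | ⟨k, rfl⟩)
    · obtain ⟨l, hl⟩ := reach_update_sibling s huv h k y
      exact ⟨l + 1, by rw [iterate_succ_apply', hl, hk, update_self]⟩
    · exact reach_update_sibling s huv h k y
  · rw [Set.disjoint_left]
    intro y hyv hyu
    exact huv (eq_of_common_descendant s hs h0 hu hv h hyu hyv)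

lemma cost_update_le (s : Fin (n + 1) → Fin (n + 1)) (hs : ∀ v, ∃ k, s^[k] v = 0)
    {v u : Fin (n + 1)} (hv : v ≠ 0) (hu : u ≠ 0) (huv : u ≠ v) (h : s u = s v)
    (hs' : ∀ w, ∃ k, (update s v u)^[k] w = 0) (d : ℕ) :
    ∀ y, depth s hs y = d → d < depth s hs v → cost 0 (update s v u) y ≤ cost 0 s y := by
  have hd : depth s hs u = depth s hs v := by
    rw [depth_of_ne_zero s hs hu, depth_of_ne_zero s hs hv, h]
  induction d with
  | zero =>
    intro y hy _
    have hy0 : y = 0 := by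
      by_contra hne
      rw [depth_of_ne_zero s hs hne] at hy
      omega
    rw [hy0, cost_zero, cost_zero]
  | succ d ih =>
    intro y hy hlt
    have hy0 : y ≠ 0 := by
      rintro rfl
      rw [depth_zero] at hy
      omega
    have hyv : y ≠ v := by
      rintro rfl
      omega
    have hsy : depth s hs (s y) = d := by
      rw [depth_of_ne_zero s hs hy0] at hy
      omega
    have hsu : s y ≠ u := by
      intro he
      rw [he] at hsy
      omega
    rw [cost_of_ne_zero _ hs' hy0, cost_of_ne_zero _ hs hy0, update_of_ne hyv]
    refine add_le_add (ENNReal.div_le_div ?_ ?_) (ih (s y) hsy (by omega))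
    · exact_mod_cast indeg_update_le s hsu
    · exact_mod_cast subtreeSize_le_update s huv h y

/-- In a stable tree, a node whose subtree is at least as large as that of some sibling has
at least about half the in-degree of its parent. -/
lemma indeg_parent_le (s : Fin (n + 1) → Fin (n + 1)) (hst : IsStable 0 s)
    (hs : ∀ v, ∃ k, s^[k] v = 0) {v u : Fin (n + 1)} (hv : v ≠ 0) (hu : u ≠ 0) (huv : u ≠ v)
    (h : s u = s v) (hle : subtreeSize s v ≤ subtreeSize s u) :
    indeg 0 s (s v) ≤ 2 * indeg 0 s u + 1 := by
  have h0 : s 0 = 0 := hst.1.1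
  have hs' : ∀ w, ∃ k, (update s v u)^[k] w = 0 := by
    intro w
    obtain ⟨k, hk⟩ := hs w
    rw [← hk]
    exact reach_update_sibling s huv h k w
  have hxu : s v ≠ u := by
    rw [← h]
    exact hst.1.2 u hu
  have hcost := hst.2 v hv u huv
  have htail := cost_update_le s hs hv hu huv h hs' _ (s v) rfl
    (by rw [depth_of_ne_zero s hs hv]; omega)
  rw [cost_of_ne_zero _ hs hv, cost_of_ne_zero _ hs' hv, update_self,
    cost_of_ne_zero _ hs' hu, update_of_ne huv, h, ← add_assoc] at hcost
  have hcost := ENNReal.le_of_add_le_add_right (cost_ne_top s hs (s v))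
    (hcost.trans (add_le_add_right htail _))
  have ha := subtreeSize_pos s v
  have ha' := subtreeSize_pos (update s v u) v
  have hb' := subtreeSize_pos (update s v u) u
  have hsv := subtreeSize_le_update s huv h v
  have hsu := subtreeSize_add_le_update s hs h0 hv hu huv h
  have hiu := indeg_update_target_le s v u
  have hix := indeg_update_source_add_one_le s hv hxu
  generalize indeg 0 s (s v) = k at *
  generalize indeg 0 s u = i at *
  generalize subtreeSize s v = a at *
  generalize subtreeSize s u = b at *
  generalize indeg 0 (update s v u) u = i' at *
  generalize indeg 0 (update s v u) (s v) = k' at *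
  generalize subtreeSize (update s v u) v = a' at *
  generalize subtreeSize (update s v u) u = b' at *
  have hbound : (k : ℝ≥0∞) / (a : ℝ≥0∞) ≤
      ((i + 1 : ℕ) : ℝ≥0∞) / (a : ℝ≥0∞) + ((k - 1 : ℕ) : ℝ≥0∞) / ((2 * a : ℕ) : ℝ≥0∞) := by
    refine hcost.trans (add_le_add (ENNReal.div_le_div ?_ ?_) (ENNReal.div_le_div ?_ ?_)) <;>
      norm_cast <;> omega
  have ha0 : (a : ℝ≥0∞) ≠ 0 := by exact_mod_cast ha.ne'
  have h2a0 : ((2 * a : ℕ) : ℝ≥0∞) ≠ 0 := by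
    have : 2 * a ≠ 0 := by omega
    exact_mod_cast this
  have hreal := ENNReal.toReal_mono
    (ENNReal.add_ne_top.2 ⟨ENNReal.div_ne_top (ENNReal.natCast_ne_top _) ha0,
      ENNReal.div_ne_top (ENNReal.natCast_ne_top _) h2a0⟩) hbound
  rw [ENNReal.toReal_add (ENNReal.div_ne_top (ENNReal.natCast_ne_top _) ha0)
    (ENNReal.div_ne_top (ENNReal.natCast_ne_top _) h2a0), ENNReal.toReal_div, ENNReal.toReal_div,
    ENNReal.toReal_div] at hreal
  simp only [ENNReal.toReal_natCast] at hreal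
  have haR : (0 : ℝ) < a := by exact_mod_cast ha
  have hk1 : ((k - 1 : ℕ) : ℝ) = k - 1 := by
    rw [Nat.cast_sub (by omega), Nat.cast_one]
  rw [hk1] at hreal
  push_cast at hreal
  have hsum : ((i : ℝ) + 1) / a + ((k : ℝ) - 1) / (2 * a) =
      (2 * (i + 1) + (k - 1)) / 2 / a := by
    field_simp
  rw [hsum, div_le_div_iff_of_pos_right haR] at hreal
  have : (k : ℝ) ≤ 2 * i + 1 := by linarith
  exact_mod_cast this

lemma sum_subtreeSize_children_le (s : Fin (n + 1) → Fin (n + 1))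
    (hs : ∀ v, ∃ k, s^[k] v = 0) (h0 : s 0 = 0) (x : Fin (n + 1)) (A : Finset (Fin (n + 1)))
    (hA : ∀ u ∈ A, u ≠ 0 ∧ s u = x) : ∑ u ∈ A, subtreeSize s u ≤ subtreeSize s x := by
  have hcard : ∀ u, subtreeSize s u = (Finset.univ.filter fun w => ∃ k, s^[k] w = u).card := by
    intro u
    rw [subtreeSize, Nat.card_coe_set_eq, Set.ncard_eq_toFinset_card']
    simp
  simp only [hcard]
  rw [← Finset.card_biUnion]
  · refine Finset.card_le_card ?_
    intro w hw
    simp only [Finset.mem_biUnion, Finset.mem_filter, Finset.mem_univ, true_and] at hw ⊢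
    obtain ⟨u, hu, k, hk⟩ := hw
    exact ⟨k + 1, by rw [iterate_succ_apply', hk, (hA u hu).2]⟩
  · intro u hu v hv huv
    refine Finset.disjoint_left.2 ?_
    intro w hwu hwv
    simp only [Finset.mem_filter, Finset.mem_univ, true_and] at hwu hwv
    exact huv (eq_of_common_descendant s hs h0 (hA u hu).1 (hA v hv).1
      ((hA u hu).2.trans (hA v hv).2.symm) hwu hwv)

/-- In a stable tree, the size of a subtree is quasi-polynomial in the in-degree of its root. -/
lemma two_pow_choose_le_subtreeSize (s : Fin (n + 1) → Fin (n + 1)) (hst : IsStable 0 s)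
    (hs : ∀ v, ∃ k, s^[k] v = 0) (j : ℕ) :
    ∀ x, 2 ^ j ≤ indeg 0 s x + 1 → 2 ^ j.choose 2 ≤ subtreeSize s x := by
  induction j with
  | zero => exact fun x _ => subtreeSize_pos s x
  | succ j ih =>
    intro x hx
    rcases Nat.eq_zero_or_pos j with rfl | hj
    · exact subtreeSize_pos s x
    have h2j : 2 ≤ 2 ^ j := Nat.le_self_pow hj.ne' 2
    rw [pow_succ] at hx
    set A : Finset (Fin (n + 1)) := Finset.univ.filter fun u => u ≠ 0 ∧ s u = x with hAdef
    have hA : indeg 0 s x = A.card := by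
      rw [indeg, Nat.card_coe_set_eq, Set.ncard_eq_toFinset_card']
      simp [hAdef]
    have hmem : ∀ u ∈ A, u ≠ 0 ∧ s u = x := by
      intro u hu
      simpa [hAdef] using hu
    obtain ⟨v, hvA, hmin⟩ := A.exists_min_image (subtreeSize s)
      (Finset.card_pos.1 (by omega))
    have hlarge : ∀ u ∈ A.erase v, 2 ^ j.choose 2 ≤ subtreeSize s u := by
      intro u hu
      obtain ⟨hne, huA⟩ := Finset.mem_erase.1 hu
      have := indeg_parent_le s hst hs (hmem v hvA).1 (hmem u huA).1 hne
        ((hmem u huA).2.trans (hmem v hvA).2.symm) (hmin u huA)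
      rw [(hmem v hvA).2] at this
      exact ih u (by omega)
    have hsum := sum_subtreeSize_children_le s hs hst.1.1 x (A.erase v)
      fun u hu => hmem u (Finset.mem_of_mem_erase hu)
    have hcard : 2 ^ j ≤ (A.erase v).card := by
      rw [Finset.card_erase_of_mem hvA]
      omega
    calc 2 ^ (j + 1).choose 2 = 2 ^ j * 2 ^ j.choose 2 := by
          rw [← pow_add, Nat.choose_succ_succ' j 1, Nat.choose_one_right]
      _ ≤ (A.erase v).card * 2 ^ j.choose 2 := Nat.mul_le_mul_right _ hcard
      _ ≤ ∑ u ∈ A.erase v, subtreeSize s u := by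
          simpa using Finset.card_nsmul_le_sum _ _ _ hlarge
      _ ≤ subtreeSize s x := hsum

/-- There is a constant `C > 0` such that for every `n ≥ 2` and every
stable tree with `n` agents, the in-degree of the root is at most `2^{C·√(log₂ n)}`. -/
theorem root_indegree_upper_bound :
    ∃ C : ℝ, 0 < C ∧
      ∀ n : ℕ, 2 ≤ n → ∀ s : Fin (n + 1) → Fin (n + 1),
        IsStable 0 s → (∀ v, ∃ k, s^[k] v = 0) →
        (indeg 0 s 0 : ℝ) ≤ (2 : ℝ) ^ (C * Real.sqrt (Real.logb 2 (n : ℝ))) := by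
  refine ⟨4, by norm_num, fun n hn s hst hs => ?_⟩
  set d := indeg 0 s 0
  set j := Nat.log 2 (d + 1)
  have hsize : 2 ^ j.choose 2 ≤ n ^ 2 := by
    have h1 := two_pow_choose_le_subtreeSize s hst hs j 0 (Nat.pow_log_le_self 2 (by omega))
    have h2 : subtreeSize s 0 ≤ n + 1 := by
      unfold subtreeSize
      rw [Nat.card_coe_set_eq]
      simpa using Set.ncard_le_card {w : Fin (n + 1) | ∃ k, s^[k] w = 0}
    nlinarith
  have hd : d + 1 < 2 ^ (j + 1) := Nat.lt_pow_succ_log_self (by norm_num) _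
  have hnR : (2 : ℝ) ≤ n := by exact_mod_cast hn
  set L := Real.logb 2 (n : ℝ)
  have hL1 : 1 ≤ L := by
    rw [Real.le_logb_iff_rpow_le (by norm_num) (by linarith)]
    simpa using hnR
  have hlog : (j.choose 2 : ℝ) ≤ 2 * L := by
    have h1 : ((2 : ℝ) ^ j.choose 2) ≤ (n : ℝ) ^ 2 := by exact_mod_cast hsize
    have h2 := Real.logb_le_logb_of_le (b := 2) (by norm_num) (by positivity) h1
    rw [Real.logb_pow, Real.logb_pow, Real.logb_self_eq_one (by norm_num)] at h2
    simpa using h2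
  have hq : 1 ≤ √L := Real.one_le_sqrt.2 hL1
  have hq2 : √L * √L = L := Real.mul_self_sqrt (by linarith)
  have hj : (j : ℝ) + 1 ≤ 4 * √L := by
    rw [Nat.cast_choose_two] at hlog
    nlinarith
  calc (d : ℝ) ≤ (2 : ℝ) ^ (j + 1) := by
        have : d ≤ 2 ^ (j + 1) := by omega
        exact_mod_cast this
    _ = (2 : ℝ) ^ ((j : ℝ) + 1) := by
        rw [← Real.rpow_natCast]
        push_cast
        rfl
    _ ≤ (2 : ℝ) ^ (4 * √L) := Real.rpow_le_rpow_of_exponent_le (by norm_num) hj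

end TCG
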